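/- arXiv:2105.07999 — 2 statements merged into one kernel-verified Lean document; each statement's English description precedes it below -/
import Mathlib

section
/- Let H be a complex Hilbert space, F : ℕ → H and G : ℕ → H families with ⟨G m, F n⟩ = δ_{m,n} for all m, n ∈ ℕ. Suppose the map U : H → ℓ²(ℕ, ℂ) given by (U y)_n = ⟨y, G n⟩ is well defined, linear, injective, has closed graph, and has closed range. Then there exist constants 0 < a₀ ≤ b₀ with a₀‖y‖² ≤ ∑_{n∈ℕ} |⟨y, G n⟩|² ≤ b₀‖y‖² for all y ∈ H, and there exists a bounded linear operator Θ† : ℓ²(ℕ, ℂ) → H with Θ†(U y) = y for all y ∈ H; that is, (G, Θ†) is a retro frame for H and it is a strong dual of F. (Sufficiency part of the proposition on existence of strong dual retro frames.) -/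
open scoped InnerProductSpace

/-- A bounded operator between Hilbert spaces that is injective with closed range has a bounded
left inverse. -/
theorem ContinuousLinearMap.exists_leftInverse_of_isClosed_range {E K : Type*}
    [NormedAddCommGroup E] [InnerProductSpace ℂ E] [CompleteSpace E]
    [NormedAddCommGroup K] [InnerProductSpace ℂ K] [CompleteSpace K]
    (T : E →L[ℂ] K) (hinj : Function.Injective T) (hrange : IsClosed (Set.range T)) :
    ∃ S : K →L[ℂ] E, ∀ x, S (T x) = x := by
  have hcl : IsClosed (T.range : Set K) := hrange
  have : CompleteSpace T.range := hcl.completeSpace_coe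
  refine ⟨(T.equivRange hinj hrange).symm.toContinuousLinearMap ∘L
    T.range.orthogonalProjectionOnto, fun x => ?_⟩
  have h : T.range.orthogonalProjectionOnto (T x) = T.equivRange hinj hrange x := by
    rw [ContinuousLinearMap.coe_equivRange]
    exact T.range.orthogonalProjectionOnto_mem_subspace_eq_self ⟨T x, x, rfl⟩
  rw [ContinuousLinearMap.comp_apply, h]
  exact (T.equivRange hinj hrange).symm_apply_apply x

/-- Bounded operators with a bounded left inverse distort squared norms by a bounded factor. -/
theorem ContinuousLinearMap.exists_sq_norm_bounds_of_leftInverse {E K : Type*}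
    [NormedAddCommGroup E] [NormedSpace ℂ E] [NormedAddCommGroup K] [NormedSpace ℂ K]
    (T : E →L[ℂ] K) (S : K →L[ℂ] E) (hS : ∀ x, S (T x) = x) :
    ∃ a b : ℝ, 0 < a ∧ a ≤ b ∧
      ∀ x, a * ‖x‖ ^ 2 ≤ ‖T x‖ ^ 2 ∧ ‖T x‖ ^ 2 ≤ b * ‖x‖ ^ 2 := by
  have hs : 1 ≤ ‖S‖ + 1 := by simp
  have ht : 1 ≤ ‖T‖ + 1 := by simp
  refine ⟨((‖S‖ + 1) ^ 2)⁻¹, (‖T‖ + 1) ^ 2, by positivity,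
    (inv_le_one_of_one_le₀ (one_le_pow₀ hs)).trans (one_le_pow₀ ht), fun x => ⟨?_, ?_⟩⟩
  · rw [inv_mul_le_iff₀ (by positivity), ← mul_pow]
    gcongr
    calc ‖x‖ = ‖S (T x)‖ := by rw [hS]
      _ ≤ ‖S‖ * ‖T x‖ := S.le_opNorm _
      _ ≤ (‖S‖ + 1) * ‖T x‖ := by gcongr; simp
  · rw [← mul_pow]
    gcongr
    calc ‖T x‖ ≤ ‖T‖ * ‖x‖ := T.le_opNorm _
      _ ≤ (‖T‖ + 1) * ‖x‖ := by gcongr; simp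

theorem stmt_13 {H : Type*} [NormedAddCommGroup H] [InnerProductSpace ℂ H] [CompleteSpace H]
    (F G : ℕ → H)
    (hbiortho : ∀ m n : ℕ, ⟪G m, F n⟫_ℂ = if m = n then 1 else 0)
    (U : H →ₗ[ℂ] lp (fun _ : ℕ => ℂ) 2)
    (hU : ∀ (y : H) (n : ℕ), (U y : ∀ _ : ℕ, ℂ) n = ⟪G n, y⟫_ℂ)
    (hinj : Function.Injective U)
    (hgraph : IsClosed (U.graph : Set (H × lp (fun _ : ℕ => ℂ) 2)))
    (hrange : IsClosed (Set.range U)) :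
    (∃ a₀ b₀ : ℝ, 0 < a₀ ∧ a₀ ≤ b₀ ∧
        ∀ y : H, a₀ * ‖y‖ ^ 2 ≤ ∑' n : ℕ, ‖⟪y, G n⟫_ℂ‖ ^ 2 ∧
          ∑' n : ℕ, ‖⟪y, G n⟫_ℂ‖ ^ 2 ≤ b₀ * ‖y‖ ^ 2) ∧
      ∃ Θ : lp (fun _ : ℕ => ℂ) 2 →L[ℂ] H, ∀ y : H, Θ (U y) = y := by
  let T := ContinuousLinearMap.ofIsClosedGraph hgraph
  obtain ⟨S, hS⟩ := T.exists_leftInverse_of_isClosed_range hinj hrange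
  have hsum (y : H) : ∑' n : ℕ, ‖⟪y, G n⟫_ℂ‖ ^ 2 = ‖T y‖ ^ 2 := by
    have h := lp.norm_rpow_eq_tsum (p := 2) (by norm_num) (U y)
    simp only [ENNReal.toReal_ofNat, Real.rpow_ofNat, hU] at h
    simp_rw [norm_inner_symm y]
    exact h.symm
  simp_rw [hsum]
  exact ⟨T.exists_sq_norm_bounds_of_leftInverse S hS, S, hS⟩
end

section
/- Let H be a complex Hilbert space with orthonormal basis (e_n)_{n∈ℕ} and define F : ℕ → H by F n = e_{n+1} + e_0. Then for every m ∈ ℕ, F m does not belong to the closed linear span of {F n : n ∈ ℕ, n ≠ m}. (Hence the retro frame built on (F n) is exact.) -/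
theorem stmt_16 {H : Type*} [NormedAddCommGroup H] [InnerProductSpace ℂ H] [CompleteSpace H]
    (e : HilbertBasis ℕ ℂ H) (F : ℕ → H) (hF : ∀ n : ℕ, F n = e (n + 1) + e 0) :
    ∀ m : ℕ, F m ∉ (Submodule.span ℂ (F '' {n : ℕ | n ≠ m})).topologicalClosure := by
  intro m hm
  have inner_F (n : ℕ) : inner ℂ (e (m + 1)) (F n) = if m = n then (1 : ℂ) else 0 := by
    simp [hF, orthonormal_iff_ite.mp e.orthonormal]
  have hle : (Submodule.span ℂ (F '' {n : ℕ | n ≠ m})).topologicalClosure ≤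
      (ℂ ∙ e (m + 1))ᗮ := by
    refine Submodule.topologicalClosure_minimal _ ?_ (Submodule.isClosed_orthogonal _)
    rw [Submodule.span_le]
    rintro _ ⟨n, hn, rfl⟩
    rw [SetLike.mem_coe, Submodule.mem_orthogonal_singleton_iff_inner_right, inner_F,
      if_neg (Ne.symm hn)]
  have h := Submodule.mem_orthogonal_singleton_iff_inner_right.mp (hle hm)
  simp [inner_F] at h
end
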